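/- arXiv:2110.15176 — 4 statements merged into one kernel-verified Lean document; each statement's English description precedes it below -/
import Mathlib

section
/- (Self-testing, Theorem 2.) Let {B_{k|0}} and {B_{k|1}} be Fourier families on ℂ^N, and let ψ ∈ ℂ^d ⊗ ℂ^N ⊗ ℂ^M be a unit vector whose reduced density matrix ρ_B on the middle factor is invertible. Suppose Re⟨ψ, (B̂_d(α) ⊗ 𝟙_M) ψ⟩ = d, where B̂_d(α) = ∑_{k=1}^{d-1} ( Z_d^k ⊗ B_{k|0} + γ(α)·X_d^k ⊗ B_{k|1} + δ_k(α)·Z_d^k ⊗ 𝟙_N ). Then: (i) every B_{k|y} is unitary and B_{k|y} = (B_{1|y})^k; (ii) d divides N, say N = d·n; and (iii) there exist a unitary U : ℂ^N → ℂ^d ⊗ ℂ^n and a unit vector ξ ∈ ℂ^n ⊗ ℂ^M such that U B_{1|0} U† = conj(Z_d) ⊗ 𝟙_n, U B_{1|1} U† = X_d ⊗ 𝟙_n, and the components of (𝟙_d ⊗ U ⊗ 𝟙_M)ψ satisfy ((𝟙_d ⊗ U ⊗ 𝟙_M)ψ)_{a,(b,b''),e} = α_a·δ_{ab}·ξ_{b'',e},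 i.e. the state equals |ψ(α)⟩ on the factors A⊗B' tensored with ξ on B''⊗E. -/
open Matrix Kronecker Finset
open scoped ComplexOrder

noncomputable section

/-- `ω = exp(2πi/d)`. -/
def om (d : ℕ) : ℂ := Complex.exp (2 * Real.pi * Complex.I / d)

/-- The generalized Pauli matrix `Z_d = ∑_i ω^i |i⟩⟨i|`. -/
def Zd (d : ℕ) : Matrix (Fin d) (Fin d) ℂ :=
  Matrix.diagonal fun i => om d ^ (i : ℕ)

/-- The generalized Pauli matrix `X_d = ∑_i |i+1 mod d⟩⟨i|`. -/
def Xd (d : ℕ) : Matrix (Fin d) (Fin d) ℂ :=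
  Matrix.of fun i j => if (i : ℕ) = ((j : ℕ) + 1) % d then 1 else 0

/-- `γ(α) = d / ∑_{i≠j} α_i/α_j` (sum over ordered pairs `i ≠ j`). -/
def gam (d : ℕ) (α : Fin d → ℝ) : ℝ :=
  d / ∑ i : Fin d, ∑ j : Fin d, if i ≠ j then α i / α j else 0

/-- `δ_k(α) = -(γ(α)/d) ∑_{i≠j} (α_i/α_j) ω^{k(d-j)}`. -/
def delt (d : ℕ) (α : Fin d → ℝ) (k : ℕ) : ℂ :=
  -(((gam d α : ℝ) : ℂ) / d) * ∑ i : Fin d, ∑ j : Fin d,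
    if i ≠ j then ((α i / α j : ℝ) : ℂ) * om d ^ (k * (d - (j : ℕ))) else 0

/-- A Fourier family on `ℂ^n`: `B 0 = 1`, `Bₖ†Bₖ ≤ 𝟙`, and `B_{d-k} = Bₖ†` (the latter stated
via negation in `Fin d`). -/
def IsFourierFamily (d n : ℕ) (B : Fin d → Matrix (Fin n) (Fin n) ℂ) : Prop :=
  (∀ k : Fin d, (k : ℕ) = 0 → B k = 1) ∧
  (∀ k : Fin d, ((1 : Matrix (Fin n) (Fin n) ℂ) - (B k)ᴴ * B k).PosSemidef) ∧
  (∀ k : Fin d, B (-k) = (B k)ᴴ)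

/-- The steering operator
`B̂_d(α) = ∑_{k=1}^{d-1} (Z_d^k ⊗ B_{k|0} + γ(α)·X_d^k ⊗ B_{k|1} + δ_k(α)·Z_d^k ⊗ 𝟙_n)`. -/
def steerOp (d n : ℕ) (α : Fin d → ℝ) (B0 B1 : Fin d → Matrix (Fin n) (Fin n) ℂ) :
    Matrix (Fin d × Fin n) (Fin d × Fin n) ℂ :=
  ∑ k ∈ Finset.univ.filter (fun k : Fin d => (k : ℕ) ≠ 0),
    ((Zd d ^ (k : ℕ)) ⊗ₖ B0 k
      + ((gam d α : ℝ) : ℂ) • ((Xd d ^ (k : ℕ)) ⊗ₖ B1 k)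
      + delt d α (k : ℕ) • ((Zd d ^ (k : ℕ)) ⊗ₖ (1 : Matrix (Fin n) (Fin n) ℂ)))

/-- The reduced density matrix on the middle factor of a vector `ψ ∈ ℂ^d ⊗ ℂ^n ⊗ ℂ^m`:
`ρ_B[b,b'] = ∑_{a,e} ψ_{a,b,e}·conj(ψ_{a,b',e})`. -/
def rhoB (d n m : ℕ) (ψ : (Fin d × Fin n) × Fin m → ℂ) : Matrix (Fin n) (Fin n) ℂ :=
  Matrix.of fun b b' => ∑ a : Fin d, ∑ e : Fin m, ψ ((a, b), e) * (starRingEnd ℂ) (ψ ((a, b'), e))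


def nrm {m n : Type*} [Fintype m] [Fintype n] (A : Matrix m n ℂ) : ℝ := (Aᴴ * A).trace.re

lemma nrm_eq {m n : Type*} [Fintype m] [Fintype n] (A : Matrix m n ℂ) :
    nrm A = ∑ j, ∑ i, Complex.normSq (A i j) := by
  simp [nrm, Matrix.trace, Matrix.mul_apply, Complex.normSq_apply]

lemma nrm_nonneg {m n : Type*} [Fintype m] [Fintype n] (A : Matrix m n ℂ) : 0 ≤ nrm A := by
  rw [nrm_eq]
  exact Finset.sum_nonneg fun _ _ => Finset.sum_nonneg fun _ _ => Complex.normSq_nonneg _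

lemma nrm_zero {m n : Type*} [Fintype m] [Fintype n] {A : Matrix m n ℂ} (h : nrm A = 0) :
    A = 0 := by
  rw [nrm_eq] at h
  ext i j
  rw [Finset.sum_eq_zero_iff_of_nonneg
    (fun _ _ => Finset.sum_nonneg fun _ _ => Complex.normSq_nonneg _)] at h
  have h1 := h j (Finset.mem_univ _)
  rw [Finset.sum_eq_zero_iff_of_nonneg (fun _ _ => Complex.normSq_nonneg _)] at h1
  simpa using h1 i (Finset.mem_univ _)

lemma nrm_contr {m n : Type*} [Fintype m] [Fintype n] [DecidableEq m] (B : Matrix m m ℂ)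
    (hB : (1 - Bᴴ * B).PosSemidef) (A : Matrix m n ℂ) : nrm (B * A) ≤ nrm A := by
  have h := (hB.conjTranspose_mul_mul_same A).trace_nonneg
  have e : Aᴴ * (1 - Bᴴ * B) * A = Aᴴ * A - (B * A)ᴴ * (B * A) := by
    simp only [Matrix.conjTranspose_mul, Matrix.mul_sub, Matrix.sub_mul, Matrix.mul_one,
      Matrix.mul_assoc]
  rw [e, Matrix.trace_sub] at h
  have := (Complex.le_def.1 h).1
  rw [Complex.sub_re, Complex.zero_re] at this
  exact sub_nonneg.1 this

lemma nrm_sub {m n : Type*} [Fintype m] [Fintype n] (A C : Matrix m n ℂ) (s t : ℝ) :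
    nrm ((s : ℂ) • A - (t : ℂ) • C) =
      s ^ 2 * nrm A + t ^ 2 * nrm C - 2 * s * t * (Cᴴ * A).trace.re := by
  have h : (Aᴴ * C).trace.re = (Cᴴ * A).trace.re := by
    have : (Aᴴ * C) = (Cᴴ * A)ᴴ := by simp
    rw [this, Matrix.trace_conjTranspose]; simp
  simp only [nrm, Matrix.conjTranspose_sub, Matrix.conjTranspose_smul, Matrix.sub_mul,
    Matrix.mul_sub, Matrix.trace_sub, Matrix.smul_mul, Matrix.mul_smul, Matrix.trace_smul]
  simp [h]
  ring

lemma key_le {m n : Type*} [Fintype m] [Fintype n] [DecidableEq m] (B : Matrix m m ℂ)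
    (hB : (1 - Bᴴ * B).PosSemidef) (A C : Matrix m n ℂ) (s t : ℝ) (hs : 0 < s) (ht : 0 < t) :
    (Cᴴ * B * A).trace.re ≤ (s / t * nrm A + t / s * nrm C) / 2 := by
  have h1 := nrm_nonneg ((s : ℂ) • (B * A) - (t : ℂ) • C)
  rw [nrm_sub, ← Matrix.mul_assoc] at h1
  have h2 := nrm_contr B hB A
  have e : (s / t * nrm A + t / s * nrm C) / 2 = (s ^ 2 * nrm A + t ^ 2 * nrm C) / (2 * s * t) := by
    field_simp
  rw [e, le_div_iff₀ (by positivity)]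
  nlinarith [sq_nonneg s, mul_le_mul_of_nonneg_left h2 (sq_nonneg s)]

lemma key_eq {m n : Type*} [Fintype m] [Fintype n] [DecidableEq m] (B : Matrix m m ℂ)
    (hB : (1 - Bᴴ * B).PosSemidef) (A C : Matrix m n ℂ) (s t : ℝ) (hs : 0 < s) (ht : 0 < t)
    (h : (Cᴴ * B * A).trace.re = (s / t * nrm A + t / s * nrm C) / 2) :
    (s : ℂ) • (B * A) = (t : ℂ) • C := by
  have h1 := nrm_nonneg ((s : ℂ) • (B * A) - (t : ℂ) • C)
  have h3 := nrm_sub (B * A) C s t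
  rw [← Matrix.mul_assoc] at h3
  have h2 := nrm_contr B hB A
  have e : (s / t * nrm A + t / s * nrm C) / 2 = (s ^ 2 * nrm A + t ^ 2 * nrm C) / (2 * s * t) := by
    field_simp
  rw [e, eq_div_iff (by positivity)] at h
  have : nrm ((s : ℂ) • (B * A) - (t : ℂ) • C) = 0 := by
    nlinarith [sq_nonneg s, mul_le_mul_of_nonneg_left h2 (sq_nonneg s)]
  exact sub_eq_zero.1 (nrm_zero this)

/-- slices -/
def slc (d N M : ℕ) (ψ : (Fin d × Fin N) × Fin M → ℂ) (a : Fin d) : Matrix (Fin N) (Fin M) ℂ :=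
  Matrix.of fun c e => ψ ((a, c), e)

lemma expect (d N M : ℕ) (ψ : (Fin d × Fin N) × Fin M → ℂ) (P : Matrix (Fin d) (Fin d) ℂ)
    (B : Matrix (Fin N) (Fin N) ℂ) :
    star ψ ⬝ᵥ ((P ⊗ₖ B) ⊗ₖ (1 : Matrix (Fin M) (Fin M) ℂ)).mulVec ψ =
      ∑ a, ∑ a', P a a' * ((slc d N M ψ a)ᴴ * B * slc d N M ψ a').trace := by
  simp only [dotProduct, Matrix.mulVec, Matrix.trace, Matrix.mul_apply, Fintype.sum_prod_type,
    Matrix.kroneckerMap_apply, Matrix.one_apply, slc, Matrix.diag_apply, Matrix.of_apply,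
    Matrix.conjTranspose_apply, Pi.star_apply, mul_ite, mul_one, mul_zero, ite_mul, zero_mul,
    Finset.sum_ite_eq, Finset.mem_univ, if_true, Finset.mul_sum, Finset.sum_mul]
  refine Finset.sum_congr rfl fun a _ => ?_
  rw [Finset.sum_congr rfl fun c _ => Finset.sum_comm]
  rw [Finset.sum_comm]
  refine Finset.sum_congr rfl fun a' _ => ?_
  rw [Finset.sum_comm]
  refine Finset.sum_congr rfl fun e _ => ?_
  rw [Finset.sum_comm]
  refine Finset.sum_congr rfl fun c _ => Finset.sum_congr rfl fun c' _ => ?_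
  ring

lemma om_pow (d : ℕ) [NeZero d] : IsPrimitiveRoot (om d) d :=
  Complex.isPrimitiveRoot_exp d (NeZero.ne d)

lemma om_star (d : ℕ) : star (om d) * om d = 1 := by
  rw [om, ← starRingEnd_apply, ← Complex.exp_conj, ← Complex.exp_add]
  simp [Complex.conj_ofNat]
  ring_nf
  simp

lemma Xd_apply (d : ℕ) [NeZero d] (i j : Fin d) : Xd d i j = if i = j + 1 then 1 else 0 := by
  simp only [Xd, Matrix.of_apply, Fin.ext_iff, Fin.val_add, Fin.val_one', Nat.add_mod_mod]

lemma Xd_pow (d : ℕ) [NeZero d] (m : ℕ) (i j : Fin d) :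
    (Xd d ^ m) i j = if i = j + (Fin.ofNat d m) then 1 else 0 := by
  induction m generalizing i j with
  | zero => 
    simp [Matrix.one_apply]
  | succ m ih =>
    have : (Fin.ofNat d (m+1)) = 1 + Fin.ofNat d m := by
      ext; simp [Fin.val_add, Fin.ofNat, add_comm]
    rw [pow_succ, Matrix.mul_apply]
    simp only [ih, Xd_apply, mul_ite, mul_one, mul_zero, Finset.sum_ite_eq', Finset.mem_univ, if_true, this, add_assoc]

lemma Xd_pow' (d : ℕ) [NeZero d] (k : Fin d) (i j : Fin d) :
    (Xd d ^ (k : ℕ)) i j = if i = j + k then 1 else 0 := by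
  rw [Xd_pow]; simp

lemma Zd_pow (d : ℕ) (m : ℕ) : Zd d ^ m = Matrix.diagonal fun i : Fin d => om d ^ (m * (i : ℕ)) := by
  rw [Zd, Matrix.diagonal_pow]; congr; ext i; simp [← pow_mul, mul_comm]

lemma om_sum (d : ℕ) [NeZero d] (i j : Fin d) :
    ∑ k : Fin d, om d ^ ((k : ℕ) * (d - (j : ℕ))) * om d ^ ((k : ℕ) * (i : ℕ)) =
      if i = j then (d : ℂ) else 0 := by
  have h := om_pow d
  have e : ∀ k : Fin d, om d ^ ((k : ℕ) * (d - (j : ℕ))) * om d ^ ((k : ℕ) * (i : ℕ)) =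
      (om d ^ (d - (j : ℕ) + i)) ^ (k : ℕ) := by
    intro k; rw [← pow_add, ← pow_mul]; congr 1; ring
  simp only [e]
  rw [Fin.sum_univ_eq_sum_range (fun k => (om d ^ (d - (j : ℕ) + i)) ^ k) d]
  split_ifs with hij
  · subst hij
    have : d - (i : ℕ) + i = d := by omega
    simp [this, h.pow_eq_one]
  · have h1 : om d ^ (d - (j : ℕ) + i) ≠ 1 := by
      intro h2
      have h3 := (h.pow_eq_one_iff_dvd _).1 h2
      have : d - (j:ℕ) + i = d := by
        obtain ⟨q, hq⟩ := h3
        have hi := i.2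
        have hj := j.2
        rcases q with _ | _ | q
        · omega
        · omega
        · have : d * (q + 1 + 1) = d * q + d + d := by ring
          have : 0 ≤ d * q := Nat.zero_le _
          omega
      apply hij; ext; omega
    have h2 := mul_neg_geom_sum (om d ^ (d - (j : ℕ) + i)) d
    rw [← pow_mul, mul_comm _ d, pow_mul, h.pow_eq_one, one_pow, sub_self] at h2
    exact (mul_eq_zero.1 h2).resolve_left (sub_ne_zero.2 (Ne.symm h1))

/-- D_i -/
def DD (d : ℕ) (α : Fin d → ℝ) (i : Fin d) : ℝ := ∑ l : Fin d, if l ≠ i then α l / α i else 0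

lemma gam_DD (d : ℕ) (hd : 2 ≤ d) (α : Fin d → ℝ) (hpos : ∀ i, 0 < α i) :
    0 < gam d α ∧ gam d α * ∑ i, DD d α i = d := by
  have hS : 0 < ∑ i : Fin d, ∑ j : Fin d, if i ≠ j then α i / α j else 0 := by
    have hn : ∀ i j : Fin d, 0 ≤ if i ≠ j then α i / α j else 0 := by
      intro i j; split_ifs
      · exact (div_pos (hpos _) (hpos _)).le
      · exact le_rfl
    refine Finset.sum_pos' (fun i _ => Finset.sum_nonneg fun j _ => hn i j) ⟨⟨0, by omega⟩, Finset.mem_univ _, ?_⟩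
    refine Finset.sum_pos' (fun j _ => hn _ j) ⟨⟨1, by omega⟩, Finset.mem_univ _, ?_⟩
    rw [if_pos (by simp)]
    exact div_pos (hpos _) (hpos _)
  have hd' : (0:ℝ) < d := by exact_mod_cast (by omega : 0 < d)
  refine ⟨div_pos hd' hS, ?_⟩
  have : ∑ i, DD d α i = ∑ i : Fin d, ∑ j : Fin d, if i ≠ j then α i / α j else 0 := by
    rw [Finset.sum_comm]; rfl
  rw [this, gam, div_mul_cancel₀ _ hS.ne']

lemma delt_sum (d : ℕ) [NeZero d] (hd : 2 ≤ d) (α : Fin d → ℝ) (hpos : ∀ i, 0 < α i) (i : Fin d) :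
    ∑ k ∈ Finset.univ.filter (fun k : Fin d => (k : ℕ) ≠ 0), delt d α k * om d ^ ((k : ℕ) * (i : ℕ)) =
      ((1 - gam d α * DD d α i : ℝ) : ℂ) := by
  have hd' : (d : ℂ) ≠ 0 := by exact_mod_cast (by omega : d ≠ 0)
  have h0 : delt d α 0 = -1 := by
    have h := (gam_DD d hd α hpos).2
    have h2 : (∑ i : Fin d, ∑ j : Fin d, if i ≠ j then ((α i / α j : ℝ) : ℂ) * om d ^ (0 * (d - (j : ℕ))) else 0)
        = ((∑ i, DD d α i : ℝ) : ℂ) := by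
      rw [Finset.sum_comm]
      simp [DD, apply_ite]
    rw [delt, h2, neg_mul, div_mul_eq_mul_div, ← Complex.ofReal_mul, h]
    simp [hd']
  have hall : ∑ k : Fin d, delt d α k * om d ^ ((k : ℕ) * (i : ℕ)) = ((- (gam d α * DD d α i) : ℝ) : ℂ) := by
    have e : ∀ k : Fin d, delt d α k * om d ^ ((k : ℕ) * (i : ℕ)) =
       -(((gam d α : ℝ) : ℂ) / d) * ∑ l : Fin d, ∑ j : Fin d, if l ≠ j then ((α l / α j : ℝ) : ℂ) *
         (om d ^ ((k : ℕ) * (d - (j : ℕ))) * om d ^ ((k : ℕ) * (i : ℕ))) else 0 := by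
      intro k
      rw [delt, mul_assoc]
      congr 1
      simp only [Finset.sum_mul, ite_mul, zero_mul, mul_assoc]
    simp only [e]
    rw [← Finset.mul_sum, Finset.sum_comm]
    have e2 : ∀ l : Fin d, ∑ k : Fin d, ∑ j : Fin d, (if l ≠ j then ((α l / α j : ℝ) : ℂ) *
         (om d ^ ((k : ℕ) * (d - (j : ℕ))) * om d ^ ((k : ℕ) * (i : ℕ))) else 0) =
         d * (if l ≠ i then ((α l / α i : ℝ) : ℂ) else 0) := by
      intro l
      rw [Finset.sum_comm]
      have : ∀ j : Fin d, ∑ k : Fin d, (if l ≠ j then ((α l / α j : ℝ) : ℂ) *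
         (om d ^ ((k : ℕ) * (d - (j : ℕ))) * om d ^ ((k : ℕ) * (i : ℕ))) else 0) =
         if i = j then d * (if l ≠ j then ((α l / α j : ℝ) : ℂ) else 0) else 0 := by
        intro j
        by_cases hl : l = j
        · simp [hl]
        · simp only [ne_eq, hl, not_false_eq_true, if_true, ← Finset.mul_sum, om_sum]
          split_ifs <;> simp [mul_comm]
      simp only [this]
      simp
    simp only [e2]
    rw [← Finset.mul_sum, DD]
    push_cast
    field_simp
    congr 2
    refine Finset.sum_congr rfl fun x _ => ?_
    split_ifs <;> simp
  have hs := Finset.sum_filter_add_sum_filter_not Finset.univ (fun k : Fin d => (k : ℕ) ≠ 0)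
    (fun k => delt d α k * om d ^ ((k : ℕ) * (i : ℕ)))
  rw [hall] at hs
  have h1 : Finset.univ.filter (fun k : Fin d => ¬ ((k : ℕ) ≠ 0)) = {0} := by
    ext k; rw [Finset.mem_filter, Finset.mem_singleton, Fin.ext_iff]; simp
  rw [h1, Finset.sum_singleton] at hs
  simp only [Fin.val_zero, h0, zero_mul, pow_zero, mul_one] at hs
  rw [← sub_eq_add_neg, sub_eq_iff_eq_add] at hs
  rw [hs]; push_cast; ring

lemma exists_iso (N M : ℕ) (φ : Matrix (Fin N) (Fin M) ℂ) :
    ∃ (n : ℕ) (Q : Matrix (Fin N) (Fin n) ℂ) (R : Matrix (Fin M) (Fin n) ℂ),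
      Qᴴ * Q = 1 ∧ Q * Qᴴ * φ = φ ∧ Q = φ * R := by
  let S := LinearMap.range (Matrix.toEuclideanLin φ)
  let b := stdOrthonormalBasis ℂ S
  have hR : ∀ j, ∃ v, Matrix.toEuclideanLin φ v = (b j : EuclideanSpace ℂ (Fin N)) := fun j => (b j).2
  choose v hv using hR
  let Q : Matrix (Fin N) (Fin (Module.finrank ℂ S)) ℂ := Matrix.of fun c j => (b j : EuclideanSpace ℂ (Fin N)) c
  refine ⟨Module.finrank ℂ S, Q, Matrix.of fun e j => v j e, ?_, ?_, ?_⟩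
  · ext i j
    have h := orthonormal_iff_ite.1 b.orthonormal i j
    rw [Submodule.coe_inner, EuclideanSpace.inner_eq_star_dotProduct] at h
    rw [Matrix.one_apply, ← h]
    simp [Matrix.mul_apply, Q, dotProduct, mul_comm]
  · ext c e
    let w : S := ⟨Matrix.toEuclideanLin φ (EuclideanSpace.single e 1), ⟨_, rfl⟩⟩
    have hw : ∀ c, (w : EuclideanSpace ℂ (Fin N)) c = φ c e := by
      intro c
      simp [w, Matrix.toLpLin_apply]
    have h := congrArg (fun x : S => (x : EuclideanSpace ℂ (Fin N)) c) (b.sum_repr' w)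
    simp only [hw] at h
    rw [← h, Matrix.mul_assoc, Matrix.mul_apply]
    simp only [Submodule.coe_sum, Submodule.coe_smul, WithLp.ofLp_sum, Finset.sum_apply, WithLp.ofLp_smul, Pi.smul_apply, smul_eq_mul]
    refine Finset.sum_congr rfl fun j _ => ?_
    rw [Submodule.coe_inner, EuclideanSpace.inner_eq_star_dotProduct, mul_comm]
    simp [Q, Matrix.mul_apply, dotProduct, hw, mul_comm]
  · ext c j
    simp only [Q, Matrix.of_apply, ← hv, Matrix.toLpLin_apply, Matrix.mul_apply, Matrix.mulVec, dotProduct]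

/-- expectation functional -/
def EL (d N M : ℕ) (ψ : (Fin d × Fin N) × Fin M → ℂ) :
    Matrix (Fin d × Fin N) (Fin d × Fin N) ℂ →ₗ[ℂ] ℂ where
  toFun T := star ψ ⬝ᵥ (T ⊗ₖ (1 : Matrix (Fin M) (Fin M) ℂ)).mulVec ψ
  map_add' S T := by rw [Matrix.add_kronecker, Matrix.add_mulVec, dotProduct_add]
  map_smul' c T := by
    rw [Matrix.smul_kronecker, Matrix.smul_mulVec, dotProduct_smul]; rfl

lemma EL_Z (d N M : ℕ) (ψ : (Fin d × Fin N) × Fin M → ℂ) (k : ℕ) (B : Matrix (Fin N) (Fin N) ℂ) :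
    EL d N M ψ ((Zd d ^ k) ⊗ₖ B) =
      ∑ a : Fin d, ((slc d N M ψ a)ᴴ * (om d ^ (k * (a : ℕ)) • B) * slc d N M ψ a).trace := by
  refine (expect d N M ψ _ _).trans (Finset.sum_congr rfl fun a _ => ?_)
  rw [Zd_pow, Finset.sum_eq_single a]
  · rw [Matrix.diagonal_apply_eq, Matrix.mul_smul, Matrix.smul_mul, Matrix.trace_smul, smul_eq_mul]
  · intro b _ hb; rw [Matrix.diagonal_apply_ne _ hb.symm, zero_mul]
  · simp

lemma EL_X (d N M : ℕ) [NeZero d] (ψ : (Fin d × Fin N) × Fin M → ℂ) (k : Fin d)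
    (B : Matrix (Fin N) (Fin N) ℂ) :
    EL d N M ψ ((Xd d ^ (k : ℕ)) ⊗ₖ B) =
      ∑ a : Fin d, ((slc d N M ψ (a + k))ᴴ * B * slc d N M ψ a).trace := by
  refine (expect d N M ψ _ _).trans ?_
  rw [Finset.sum_comm]
  refine Finset.sum_congr rfl fun a _ => ?_
  simp only [Xd_pow', ite_mul, one_mul, zero_mul, Finset.sum_ite_eq', Finset.mem_univ, if_true]

lemma hexp (d N M : ℕ) [NeZero d] (hd : 2 ≤ d)
    (α : Fin d → ℝ) (hpos : ∀ i, 0 < α i)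
    (B0 B1 : Fin d → Matrix (Fin N) (Fin N) ℂ)
    (ψ : (Fin d × Fin N) × Fin M → ℂ) :
    (EL d N M ψ (steerOp d N α B0 B1)).re =
    (∑ k ∈ Finset.univ.filter (fun k : Fin d => (k : ℕ) ≠ 0), ∑ a : Fin d,
      (((slc d N M ψ a)ᴴ * (om d ^ ((k : ℕ) * (a : ℕ)) • B0 k) * slc d N M ψ a).trace.re
       + gam d α * ((slc d N M ψ (a + k))ᴴ * B1 k * slc d N M ψ a).trace.re))
    + ∑ a, (1 - gam d α * DD d α a) * nrm (slc d N M ψ a) := by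
  have h3 : ∑ k ∈ Finset.univ.filter (fun k : Fin d => (k : ℕ) ≠ 0),
      EL d N M ψ (delt d α (k : ℕ) • ((Zd d ^ (k : ℕ)) ⊗ₖ (1 : Matrix (Fin N) (Fin N) ℂ))) =
      ∑ a, ((1 - gam d α * DD d α a : ℝ) : ℂ) * ((slc d N M ψ a)ᴴ * slc d N M ψ a).trace := by
    simp only [← delt_sum d hd α hpos]
    simp only [map_smul, EL_Z, Matrix.mul_smul, Matrix.smul_mul, Matrix.mul_one, Matrix.trace_smul,
      smul_eq_mul, Finset.mul_sum, Finset.sum_mul]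
    rw [Finset.sum_comm]
    simp only [mul_assoc]
  rw [steerOp, map_sum]
  simp only [map_add]
  rw [Finset.sum_add_distrib, h3, Complex.add_re, Complex.re_sum, Complex.re_sum]
  congr 1
  · refine Finset.sum_congr rfl fun k _ => ?_
    rw [map_smul, EL_Z, EL_X, smul_eq_mul, Complex.add_re, Complex.re_ofReal_mul, Complex.re_sum,
      Complex.re_sum, Finset.sum_add_distrib, Finset.mul_sum]
  · refine Finset.sum_congr rfl fun k _ => ?_
    rw [Complex.re_ofReal_mul]; rfl

lemma D_sum (d : ℕ) [NeZero d] (α : Fin d → ℝ) (x : Fin d → ℝ) :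
    ∑ k ∈ Finset.univ.filter (fun k : Fin d => (k : ℕ) ≠ 0), ∑ a : Fin d,
      (α (a + k) / α a * x a + α a / α (a + k) * x (a + k)) / 2 = ∑ a, DD d α a * x a := by
  have hne : ∀ k : Fin d, ((k : ℕ) ≠ 0) ↔ k ≠ 0 := by
    intro k; rw [ne_eq, ne_eq, Fin.ext_iff]; simp
  simp only [hne]
  have h1 : ∑ k ∈ Finset.univ.filter (fun k : Fin d => k ≠ 0), ∑ a : Fin d,
      (α (a + k) / α a * x a) = ∑ a, DD d α a * x a := by
    rw [Finset.sum_comm]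
    refine Finset.sum_congr rfl fun a _ => ?_
    rw [DD, Finset.sum_mul, Finset.sum_filter]
    rw [← Equiv.sum_comp (Equiv.addLeft a) (fun l => (if l ≠ a then α l / α a else 0) * x a)]
    refine Finset.sum_congr rfl fun k _ => ?_
    simp
  have h2 : ∑ k ∈ Finset.univ.filter (fun k : Fin d => k ≠ 0), ∑ a : Fin d,
      (α a / α (a + k) * x (a + k)) = ∑ a, DD d α a * x a := by
    rw [← h1, Finset.sum_filter, Finset.sum_filter, ← Equiv.sum_comp (Equiv.neg (Fin d))]
    refine Finset.sum_congr rfl fun k _ => ?_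
    simp only [Equiv.neg_apply, ne_eq, neg_eq_zero]
    split_ifs
    · rfl
    · rw [← Equiv.sum_comp (Equiv.addRight k)]
      simp
  simp only [← Finset.sum_div]
  simp only [Finset.sum_add_distrib]
  rw [h1, h2]; ring

lemma contr_smul (N : ℕ) (c : ℂ) (hc : star c * c = 1) (B : Matrix (Fin N) (Fin N) ℂ)
    (hB : (1 - Bᴴ * B).PosSemidef) : (1 - (c • B)ᴴ * (c • B)).PosSemidef := by
  rw [Matrix.conjTranspose_smul, Matrix.smul_mul, Matrix.mul_smul, smul_smul, hc, one_smul]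
  exact hB

lemma om_pow_star (d m : ℕ) : star (om d ^ m) * om d ^ m = 1 := by
  rw [star_pow, ← mul_pow, om_star, one_pow]

lemma nrm_slc_sum (d N M : ℕ) (ψ : (Fin d × Fin N) × Fin M → ℂ)
    (hψ : ∑ p, Complex.normSq (ψ p) = 1) : ∑ a, nrm (slc d N M ψ a) = 1 := by
  rw [← hψ]
  simp only [nrm_eq, Fintype.sum_prod_type, slc, Matrix.of_apply]
  refine Finset.sum_congr rfl fun a _ => Finset.sum_comm

lemma relations (d N M : ℕ) [NeZero d] (hd : 2 ≤ d)
    (α : Fin d → ℝ) (hpos : ∀ i, 0 < α i)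
    (B0 B1 : Fin d → Matrix (Fin N) (Fin N) ℂ)
    (hB0 : IsFourierFamily d N B0) (hB1 : IsFourierFamily d N B1)
    (ψ : (Fin d × Fin N) × Fin M → ℂ) (hψ : ∑ p, Complex.normSq (ψ p) = 1)
    (hmax : (EL d N M ψ (steerOp d N α B0 B1)).re = d) :
    ∀ k a : Fin d, (om d ^ ((k : ℕ) * (a : ℕ)) • B0 k) * slc d N M ψ a = slc d N M ψ a ∧
      (α (a + k) : ℂ) • (B1 k * slc d N M ψ a) = (α a : ℂ) • slc d N M ψ (a + k) := by
  have hn := nrm_slc_sum d N M ψ hψ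
  have hg := (gam_DD d hd α hpos).1
  rw [hexp d N M hd α hpos] at hmax
  set Φ := slc d N M ψ with hΦ
  have hD := D_sum d α (fun a => nrm (Φ a))
  have c0 : ∀ k a : Fin d, (1 - (om d ^ ((k : ℕ) * (a : ℕ)) • B0 k)ᴴ * (om d ^ ((k : ℕ) * (a : ℕ)) • B0 k)).PosSemidef :=
    fun k a => contr_smul N _ (om_pow_star d _) _ (hB0.2.1 k)
  have l0 : ∀ k a : Fin d, ((Φ a)ᴴ * (om d ^ ((k : ℕ) * (a : ℕ)) • B0 k) * Φ a).trace.re ≤ nrm (Φ a) := by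
    intro k a
    have := key_le _ (c0 k a) (Φ a) (Φ a) 1 1 one_pos one_pos
    linarith
  have l1 : ∀ k a : Fin d, ((Φ (a + k))ᴴ * B1 k * Φ a).trace.re ≤
      (α (a + k) / α a * nrm (Φ a) + α a / α (a + k) * nrm (Φ (a + k))) / 2 :=
    fun k a => key_le _ (hB1.2.1 k) (Φ a) (Φ (a + k)) _ _ (hpos _) (hpos _)
  have hcard : (Finset.univ.filter (fun k : Fin d => (k : ℕ) ≠ 0)).card = d - 1 := by
    have : Finset.univ.filter (fun k : Fin d => (k : ℕ) ≠ 0) = Finset.univ.erase 0 := by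
      ext k; rw [Finset.mem_filter, Finset.mem_erase, ne_eq, ne_eq, Fin.ext_iff]; simp
    rw [this, Finset.card_erase_of_mem (Finset.mem_univ _)]; simp
  have hzero : ∑ k ∈ Finset.univ.filter (fun k : Fin d => (k : ℕ) ≠ 0), ∑ a : Fin d,
      ((nrm (Φ a) - ((Φ a)ᴴ * (om d ^ ((k : ℕ) * (a : ℕ)) • B0 k) * Φ a).trace.re) +
       gam d α * ((α (a + k) / α a * nrm (Φ a) + α a / α (a + k) * nrm (Φ (a + k))) / 2
          - ((Φ (a + k))ᴴ * B1 k * Φ a).trace.re)) = 0 := by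
    have e1 : ∑ k ∈ Finset.univ.filter (fun k : Fin d => (k : ℕ) ≠ 0), ∑ a : Fin d, nrm (Φ a) = (d : ℝ) - 1 := by
      rw [hn, Finset.sum_const, hcard, nsmul_eq_mul, mul_one, Nat.cast_sub (by omega)]; simp
    have e2 : ∑ a, (1 - gam d α * DD d α a) * nrm (Φ a) = 1 - gam d α * ∑ a, DD d α a * nrm (Φ a) := by
      rw [Finset.mul_sum]
      conv_rhs => rw [← hn]
      rw [← Finset.sum_sub_distrib]
      exact Finset.sum_congr rfl fun a _ => by ring
    have e3 : ∑ k ∈ Finset.univ.filter (fun k : Fin d => (k : ℕ) ≠ 0), ∑ a : Fin d,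
      ((nrm (Φ a) - ((Φ a)ᴴ * (om d ^ ((k : ℕ) * (a : ℕ)) • B0 k) * Φ a).trace.re) +
       gam d α * ((α (a + k) / α a * nrm (Φ a) + α a / α (a + k) * nrm (Φ (a + k))) / 2
          - ((Φ (a + k))ᴴ * B1 k * Φ a).trace.re)) =
        ∑ k ∈ Finset.univ.filter (fun k : Fin d => (k : ℕ) ≠ 0), ∑ a : Fin d, nrm (Φ a)
        + gam d α * ∑ k ∈ Finset.univ.filter (fun k : Fin d => (k : ℕ) ≠ 0), ∑ a : Fin d,
            (α (a + k) / α a * nrm (Φ a) + α a / α (a + k) * nrm (Φ (a + k))) / 2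
        - ∑ k ∈ Finset.univ.filter (fun k : Fin d => (k : ℕ) ≠ 0), ∑ a : Fin d,
           (((Φ a)ᴴ * (om d ^ ((k : ℕ) * (a : ℕ)) • B0 k) * Φ a).trace.re
           + gam d α * ((Φ (a + k))ᴴ * B1 k * Φ a).trace.re) := by
      simp only [Finset.mul_sum, ← Finset.sum_add_distrib, ← Finset.sum_sub_distrib]
      exact Finset.sum_congr rfl fun k _ => Finset.sum_congr rfl fun a _ => by ring
    rw [e3, e1, hD]
    linarith
  have s0 : ∀ k a : Fin d, 0 ≤ nrm (Φ a) - ((Φ a)ᴴ * (om d ^ ((k : ℕ) * (a : ℕ)) • B0 k) * Φ a).trace.re :=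
    fun k a => sub_nonneg.2 (l0 k a)
  have s1 : ∀ k a : Fin d, 0 ≤ gam d α * ((α (a + k) / α a * nrm (Φ a) + α a / α (a + k) * nrm (Φ (a + k))) / 2
          - ((Φ (a + k))ᴴ * B1 k * Φ a).trace.re) :=
    fun k a => mul_nonneg hg.le (sub_nonneg.2 (l1 k a))
  rw [Finset.sum_eq_zero_iff_of_nonneg
    (fun k _ => Finset.sum_nonneg fun a _ => add_nonneg (s0 k a) (s1 k a))] at hzero
  intro k a
  by_cases hk : (k : ℕ) = 0
  · have hk' : k = 0 := by rw [Fin.ext_iff]; simpa using hk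
    subst hk'
    rw [hB0.1 0 hk, hB1.1 0 hk]
    simp
  · have hz := hzero k (by simpa using hk)
    rw [Finset.sum_eq_zero_iff_of_nonneg (fun a _ => add_nonneg (s0 k a) (s1 k a))] at hz
    have hz := hz a (Finset.mem_univ _)
    have z0 : nrm (Φ a) - ((Φ a)ᴴ * (om d ^ ((k : ℕ) * (a : ℕ)) • B0 k) * Φ a).trace.re = 0 := by
      linarith [s0 k a, s1 k a]
    have z1 := (mul_eq_zero.1 (show gam d α * ((α (a + k) / α a * nrm (Φ a) + α a / α (a + k) * nrm (Φ (a + k))) / 2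
          - ((Φ (a + k))ᴴ * B1 k * Φ a).trace.re) = 0 by linarith [s0 k a, s1 k a])).resolve_left hg.ne'
    constructor
    · have := key_eq _ (c0 k a) (Φ a) (Φ a) 1 1 one_pos one_pos (by linarith)
      simpa using this
    · exact key_eq _ (hB1.2.1 k) (Φ a) (Φ (a + k)) _ _ (hpos _) (hpos _) (by linarith)

lemma faithful (d N M : ℕ) (ψ : (Fin d × Fin N) × Fin M → ℂ) (hrho : IsUnit (rhoB d N M ψ))
    (A B : Matrix (Fin N) (Fin N) ℂ) (h : ∀ a, A * slc d N M ψ a = B * slc d N M ψ a) : A = B := by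
  have e : rhoB d N M ψ = ∑ a, slc d N M ψ a * (slc d N M ψ a)ᴴ := by
    ext b b'
    simp [rhoB, slc, Matrix.sum_apply, Matrix.mul_apply]
  apply hrho.mul_right_cancel
  rw [e, Finset.mul_sum, Finset.mul_sum]
  exact Finset.sum_congr rfl fun a _ => by rw [← Matrix.mul_assoc, h, Matrix.mul_assoc]

lemma final (d N M : ℕ) [NeZero d] (hd : 2 ≤ d)
    (α : Fin d → ℝ) (hpos : ∀ i, 0 < α i) (hnorm : ∑ i, α i ^ 2 = 1)
    (B0 B1 : Fin d → Matrix (Fin N) (Fin N) ℂ)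
    (hB0 : IsFourierFamily d N B0) (hB1 : IsFourierFamily d N B1)
    (ψ : (Fin d × Fin N) × Fin M → ℂ) (hψ : ∑ p, Complex.normSq (ψ p) = 1)
    (hrho : IsUnit (rhoB d N M ψ))
    (hmax : (EL d N M ψ (steerOp d N α B0 B1)).re = d) :
    (∀ k : Fin d, (B0 k)ᴴ * B0 k = 1 ∧ (B1 k)ᴴ * B1 k = 1
      ∧ B0 k = B0 1 ^ (k : ℕ) ∧ B1 k = B1 1 ^ (k : ℕ))
    ∧ ∃ n : ℕ, N = d * n ∧
        ∃ U : Matrix (Fin d × Fin n) (Fin N) ℂ,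
          U * Uᴴ = 1 ∧ Uᴴ * U = 1
          ∧ U * B0 1 * Uᴴ = ((Zd d).map (starRingEnd ℂ)) ⊗ₖ (1 : Matrix (Fin n) (Fin n) ℂ)
          ∧ U * B1 1 * Uᴴ = Xd d ⊗ₖ (1 : Matrix (Fin n) (Fin n) ℂ)
          ∧ ∃ ξ : Fin n × Fin M → ℂ, (∑ q, Complex.normSq (ξ q) = 1) ∧
              ∀ (a b : Fin d) (b'' : Fin n) (e : Fin M),
                (∑ c : Fin N, U (b, b'') c * ψ ((a, c), e))
                  = (if a = b then (α a : ℂ) else 0) * ξ (b'', e) := by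
  have rel := relations d N M hd α hpos B0 B1 hB0 hB1 ψ hψ hmax
  have hα : ∀ a, (α a : ℂ) ≠ 0 := fun a => by exact_mod_cast (hpos a).ne'
  have hom : om d ≠ 0 := (om_pow d).ne_zero (NeZero.ne d)
  obtain ⟨φ, hφ⟩ : ∃ φ : Fin d → Matrix (Fin N) (Fin M) ℂ, ∀ a, slc d N M ψ a = (α a : ℂ) • φ a :=
    ⟨fun a => (α a : ℂ)⁻¹ • slc d N M ψ a, fun a => by rw [smul_inv_smul₀ (hα a)]⟩
  have faith : ∀ A B : Matrix (Fin N) (Fin N) ℂ, (∀ a, A * φ a = B * φ a) → A = B := by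
    intro A B h
    refine faithful d N M ψ hrho A B fun a => ?_
    rw [hφ, Matrix.mul_smul, Matrix.mul_smul, h]
  have r0 : ∀ k a, B0 k * φ a = (om d ^ ((k : ℕ) * (a : ℕ)))⁻¹ • φ a := by
    intro k a
    have h := (rel k a).1
    rw [hφ, Matrix.mul_smul, Matrix.smul_mul] at h
    have h := smul_right_injective _ (hα a) h
    rw [eq_inv_smul_iff₀ (pow_ne_zero _ hom)]
    exact h
  have r1 : ∀ k a, B1 k * φ a = φ (a + k) := by
    intro k a
    have h := (rel k a).2
    rw [hφ, hφ, Matrix.mul_smul, smul_smul, smul_smul, mul_comm] at h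
    exact smul_right_injective _ (mul_ne_zero (hα a) (hα (a + k))) h
  have u1 : ∀ k, (B1 k)ᴴ * B1 k = 1 := by
    intro k
    refine faith _ _ fun a => ?_
    rw [← hB1.2.2, Matrix.mul_assoc, r1, r1]; simp
  have p0 : ∀ k, B0 k = B0 1 ^ (k : ℕ) := by
    have h1 : ((1 : Fin d) : ℕ) = 1 := by rw [Fin.val_one', Nat.mod_eq_of_lt (by omega)]
    have : ∀ m : ℕ, ∀ a, B0 1 ^ m * φ a = (om d ^ (m * (a : ℕ)))⁻¹ • φ a := by
      intro m a
      induction m with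
      | zero => simp
      | succ m ih =>
        rw [pow_succ', Matrix.mul_assoc, ih, Matrix.mul_smul, r0, smul_smul, h1, ← mul_inv, ← pow_add]
        congr 3; ring
    intro k
    refine faith _ _ fun a => ?_
    rw [this, r0]
  have p1 : ∀ k, B1 k = B1 1 ^ (k : ℕ) := by
    have : ∀ m : ℕ, ∀ a, B1 1 ^ m * φ a = φ (a + Fin.ofNat d m) := by
      intro m a
      induction m with
      | zero => simp
      | succ m ih =>
        have : (Fin.ofNat d (m+1)) = Fin.ofNat d m + 1 := by
          ext; simp [Fin.val_add, Fin.ofNat]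
        rw [pow_succ', Matrix.mul_assoc, ih, r1, this, add_assoc]
    intro k
    refine faith _ _ fun a => ?_
    rw [this, r1]; simp
  have u0 : ∀ k, (B0 k)ᴴ * B0 k = 1 := by
    intro k
    -- B0ᴴ B0 φ
    have hneg : ∀ a, B0 (-k) * φ a = om d ^ ((k : ℕ) * (a : ℕ)) • φ a := by
      intro a
      rw [r0]
      congr 1
      rw [inv_eq_iff_eq_inv, ← mul_eq_one_iff_eq_inv₀ (pow_ne_zero _ hom), ← pow_add, ← add_mul]
      rw [(om_pow d).pow_eq_one_iff_dvd]
      apply Dvd.dvd.mul_right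
      have : (((-k + k : Fin d)) : ℕ) = 0 := by simp
      rw [Fin.val_add] at this
      exact Nat.dvd_of_mod_eq_zero this
    refine faith _ _ fun a => ?_
    rw [← hB0.2.2, Matrix.mul_assoc, r0, Matrix.mul_smul, hneg, inv_smul_smul₀ (pow_ne_zero _ hom), Matrix.one_mul]
  refine ⟨fun k => ⟨u0 k, u1 k, p0 k, p1 k⟩, ?_⟩
  -- orthogonality
  have h1v : ((1 : Fin d) : ℕ) = 1 := by rw [Fin.val_one', Nat.mod_eq_of_lt (by omega)]
  have star_inv : ∀ m, star ((om d ^ m)⁻¹) = om d ^ m := by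
    intro m
    rw [star_inv₀, inv_eq_iff_eq_inv]
    exact eq_inv_of_mul_eq_one_left (om_pow_star d m)
  have orth : ∀ a b, a ≠ b → (φ a)ᴴ * φ b = 0 := by
    intro a b hab
    have h : (B0 1 * φ a)ᴴ * (B0 1 * φ b) = (φ a)ᴴ * φ b := by
      rw [Matrix.conjTranspose_mul, Matrix.mul_assoc, ← Matrix.mul_assoc (B0 1)ᴴ, u0, Matrix.one_mul]
    rw [r0, r0, Matrix.conjTranspose_smul, Matrix.smul_mul, Matrix.mul_smul, smul_smul, h1v,
      one_mul, one_mul, star_inv] at h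
    by_contra hne
    have h2 : (om d ^ (a : ℕ) * (om d ^ (b : ℕ))⁻¹ - 1) • ((φ a)ᴴ * φ b) = 0 := by
      rw [sub_smul, h, one_smul, sub_self]
    have h3 := sub_eq_zero.1 ((smul_eq_zero.1 h2).resolve_right hne)
    rw [mul_inv_eq_one₀ (pow_ne_zero _ hom)] at h3
    exact hab (Fin.ext ((om_pow d).pow_inj a.2 b.2 h3))
  obtain ⟨n, Q, R, hQ, hQφ, hQR⟩ := exists_iso N M (φ 0)
  have hV : ∀ b, B1 b * Q = φ b * R := by
    intro b; rw [hQR, ← Matrix.mul_assoc, r1, zero_add]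
  have hQo : ∀ a, a ≠ 0 → Qᴴ * φ a = 0 := by
    intro a ha
    rw [hQR, Matrix.conjTranspose_mul, Matrix.mul_assoc, orth 0 a ha.symm, Matrix.mul_zero]
  have hadj : ∀ b a, (B1 b)ᴴ * φ a = φ (a - b) := by
    intro b a
    rw [← hB1.2.2, r1, sub_eq_add_neg]
  -- V b := B1 b * Q
  have VV : ∀ b b', (B1 b * Q)ᴴ * (B1 b' * Q) = if b = b' then 1 else 0 := by
    intro b b'
    split_ifs with h
    · subst h
      rw [Matrix.conjTranspose_mul, Matrix.mul_assoc, ← Matrix.mul_assoc (B1 b)ᴴ, u1, Matrix.one_mul, hQ]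
    · rw [hV, hV, Matrix.conjTranspose_mul, Matrix.mul_assoc, ← Matrix.mul_assoc (φ b)ᴴ, orth _ _ h]
      simp
  have Vφ : ∀ b a, (B1 b * Q)ᴴ * φ a = if a = b then Qᴴ * φ 0 else 0 := by
    intro b a
    rw [Matrix.conjTranspose_mul, Matrix.mul_assoc, hadj]
    split_ifs with h
    · rw [h, sub_self]
    · exact hQo _ (sub_ne_zero.2 h)
  let W : Matrix (Fin N) (Fin d × Fin n) ℂ := Matrix.of fun c p => (B1 p.1 * Q) c p.2
  have hWW : Wᴴ * W = 1 := by
    ext ⟨b, i⟩ ⟨b', j⟩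
    have h : (Wᴴ * W) (b, i) (b', j) = ((B1 b * Q)ᴴ * (B1 b' * Q)) i j := rfl
    rw [h, VV]
    by_cases hb : b = b'
    · simp [hb, Matrix.one_apply]
    · simp [hb, Matrix.one_apply]
  have hWsum : W * Wᴴ = ∑ b, (B1 b * Q) * (B1 b * Q)ᴴ := by
    ext c c'
    rw [Matrix.mul_apply, Fintype.sum_prod_type, Matrix.sum_apply]
    rfl
  have hWW' : W * Wᴴ = 1 := by
    refine faith _ _ fun a => ?_
    rw [hWsum, Matrix.sum_mul, Finset.sum_eq_single a]
    · rw [Matrix.mul_assoc, Vφ, if_pos rfl, Matrix.mul_assoc, ← Matrix.mul_assoc Q, hQφ, r1]; simp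
    · intro b _ hb
      rw [Matrix.mul_assoc, Vφ, if_neg hb.symm, Matrix.mul_zero]
    · simp
  have hN : N = d * n := by
    have h1 := congrArg Matrix.trace hWW
    have h2 := congrArg Matrix.trace hWW'
    rw [Matrix.trace_mul_comm, h2, Matrix.trace_one, Matrix.trace_one] at h1
    simp at h1
    exact_mod_cast h1
  have key : ∀ (B : Matrix (Fin N) (Fin N) ℂ) (T : Matrix (Fin d × Fin n) (Fin d × Fin n) ℂ),
      B * W = W * T → Wᴴ * B * Wᴴᴴ = T := by
    intro B T h
    rw [Matrix.conjTranspose_conjTranspose, Matrix.mul_assoc, h, ← Matrix.mul_assoc, hWW, Matrix.one_mul]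
  have hξ : ∀ (a b : Fin d) (b'' : Fin n) (e : Fin M),
      ∑ c : Fin N, Wᴴ (b, b'') c * ψ ((a, c), e)
        = (if a = b then (α a : ℂ) else 0) * (Qᴴ * φ 0) b'' e := by
    intro a b b'' e
    have h : ∑ c : Fin N, Wᴴ (b, b'') c * ψ ((a, c), e) = ((B1 b * Q)ᴴ * slc d N M ψ a) b'' e := rfl
    rw [h, hφ, Matrix.mul_smul, Vφ]
    split_ifs <;> simp
  have nφ : ∀ a, nrm (φ a) = nrm (φ 0) := by
    intro a
    have h : φ a = B1 a * φ 0 := by rw [r1, zero_add]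
    rw [nrm, h, Matrix.conjTranspose_mul, Matrix.mul_assoc, ← Matrix.mul_assoc (B1 a)ᴴ, u1, Matrix.one_mul]
    rfl
  have nξ : nrm (Qᴴ * φ 0) = 1 := by
    have h : nrm (Qᴴ * φ 0) = nrm (φ 0) := by
      rw [nrm, Matrix.conjTranspose_mul, Matrix.conjTranspose_conjTranspose, Matrix.mul_assoc,
        ← Matrix.mul_assoc Q, hQφ]; rfl
    have h2 := nrm_slc_sum d N M ψ hψ
    have h3 : ∀ a, nrm (slc d N M ψ a) = α a ^ 2 * nrm (φ 0) := by
      intro a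
      rw [hφ, ← nφ a]
      have := nrm_sub (φ a) 0 (α a) 0
      simpa using this
    simp only [h3] at h2
    rw [← Finset.sum_mul, hnorm, one_mul] at h2
    rw [h, h2]
  refine ⟨n, hN, Wᴴ, ?_, ?_, ?_, ?_, fun q => (Qᴴ * φ 0) q.1 q.2, ?_, hξ⟩
  · rw [Matrix.conjTranspose_conjTranspose, hWW]
  · rw [Matrix.conjTranspose_conjTranspose, hWW']
  · apply key
    ext c ⟨b, j⟩
    have h : (B0 1 * W) c (b, j) = (B0 1 * (B1 b * Q)) c j := rfl
    rw [h, hV, ← Matrix.mul_assoc, r0, Matrix.smul_mul, ← hV, h1v, one_mul]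
    rw [Matrix.mul_apply (M := W), Finset.sum_eq_single (b, j)]
    · have hs : (om d ^ (b : ℕ))⁻¹ = star (om d ^ (b : ℕ)) := by
        conv_rhs => rw [← star_inv, star_star]
      simp [W, Zd, hs, mul_comm]
    · rintro ⟨b', j'⟩ _ hne
      rw [Matrix.kroneckerMap_apply, Matrix.map_apply, Zd, Matrix.diagonal_apply, Matrix.one_apply]
      by_cases h1 : b' = b
      · have h2 : j' ≠ j := fun h2 => hne (by rw [h1, h2])
        rw [if_neg h2, mul_zero, mul_zero]
      · rw [if_neg h1, map_zero, zero_mul, mul_zero]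
    · simp
  · apply key
    ext c ⟨b, j⟩
    have h : (B1 1 * W) c (b, j) = (B1 1 * (B1 b * Q)) c j := rfl
    rw [h, hV, ← Matrix.mul_assoc, r1, ← hV]
    rw [Matrix.mul_apply (M := W), Finset.sum_eq_single (b + 1, j)]
    · simp [W, Xd_apply]
    · rintro ⟨b', j'⟩ _ hne
      rw [Matrix.kroneckerMap_apply, Xd_apply, Matrix.one_apply]
      by_cases h1 : b' = b + 1
      · have h2 : j' ≠ j := fun h2 => hne (by rw [h1, h2])
        rw [if_neg h2, mul_zero, mul_zero]
      · rw [if_neg h1, zero_mul, mul_zero]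
    · simp
  · rw [← nξ, nrm_eq, Fintype.sum_prod_type, Finset.sum_comm]

/-- Theorem 2, self-testing: maximal violation of the steering inequality
certifies that Bob's measurements are projective and, up to a local unitary `U`, equal to
`conj(Z_d) ⊗ 𝟙` and `X_d ⊗ 𝟙`, and that the shared state is `|ψ(α)⟩ ⊗ ξ`. -/
theorem self_testing (d N M : ℕ) [NeZero d] (hd : 2 ≤ d)
    (α : Fin d → ℝ) (hpos : ∀ i, 0 < α i) (hnorm : ∑ i, α i ^ 2 = 1)
    (B0 B1 : Fin d → Matrix (Fin N) (Fin N) ℂ)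
    (hB0 : IsFourierFamily d N B0) (hB1 : IsFourierFamily d N B1)
    (ψ : (Fin d × Fin N) × Fin M → ℂ) (hψ : ∑ p, Complex.normSq (ψ p) = 1)
    (hrho : IsUnit (rhoB d N M ψ))
    (hmax : (star ψ ⬝ᵥ ((steerOp d N α B0 B1) ⊗ₖ (1 : Matrix (Fin M) (Fin M) ℂ)).mulVec ψ).re
      = d) :
    (∀ k : Fin d, (B0 k)ᴴ * B0 k = 1 ∧ (B1 k)ᴴ * B1 k = 1
      ∧ B0 k = B0 1 ^ (k : ℕ) ∧ B1 k = B1 1 ^ (k : ℕ))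
    ∧ ∃ n : ℕ, N = d * n ∧
        ∃ U : Matrix (Fin d × Fin n) (Fin N) ℂ,
          U * Uᴴ = 1 ∧ Uᴴ * U = 1
          ∧ U * B0 1 * Uᴴ = ((Zd d).map (starRingEnd ℂ)) ⊗ₖ (1 : Matrix (Fin n) (Fin n) ℂ)
          ∧ U * B1 1 * Uᴴ = Xd d ⊗ₖ (1 : Matrix (Fin n) (Fin n) ℂ)
          ∧ ∃ ξ : Fin n × Fin M → ℂ, (∑ q, Complex.normSq (ξ q) = 1) ∧
              ∀ (a b : Fin d) (b'' : Fin n) (e : Fin M),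
                (∑ c : Fin N, U (b, b'') c * ψ ((a, c), e))
                  = (if a = b then (α a : ℂ) else 0) * ξ (b'', e) := by
  exact final d N M hd α hpos hnorm B0 B1 hB0 hB1 ψ hψ hrho hmax
end
end

section
/- Let ω = exp(2πi/3), let B_0, B_1 be unitary N×N matrices, and let R_1, R_2 be orthogonal projections on ℂ^N such that B_0B_1R_1 = ω²·B_1B_0R_1 and B_0B_1R_2 = ω·B_1B_0R_2. Then R_2R_1 = 0, i.e. the ranges of R_1 and R_2 are orthogonal. -/
open Matrix Kronecker Finset
open scoped ComplexOrder

noncomputable section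

/-- if unitaries `B₀, B₁` satisfy `B₀B₁R₁ = ω²B₁B₀R₁` and `B₀B₁R₂ = ωB₁B₀R₂`
(ω = exp(2πi/3)) for orthogonal projections `R₁, R₂`, then `R₂R₁ = 0`. -/
theorem orthogonal_supports (Nn : ℕ) (B0 B1 R1 R2 : Matrix (Fin Nn) (Fin Nn) ℂ)
    (hB0u : B0ᴴ * B0 = 1) (hB0u' : B0 * B0ᴴ = 1)
    (hB1u : B1ᴴ * B1 = 1) (hB1u' : B1 * B1ᴴ = 1)
    (hR1h : R1ᴴ = R1) (hR1p : R1 * R1 = R1)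
    (hR2h : R2ᴴ = R2) (hR2p : R2 * R2 = R2)
    (h1 : B0 * B1 * R1 = (om 3) ^ 2 • (B1 * B0 * R1))
    (h2 : B0 * B1 * R2 = om 3 • (B1 * B0 * R2)) :
    R2 * R1 = 0 := by
  have hprim : IsPrimitiveRoot (om 3) 3 := by
    have := Complex.isPrimitiveRoot_exp 3 (by norm_num)
    simpa [om] using this
  have hne : om 3 ≠ 1 := hprim.ne_one (by norm_num)
  have hn : star (om 3) * om 3 = 1 := by
    have h := hprim.norm'_eq_one (by norm_num)
    have h' := Complex.conj_mul' (om 3)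
    rw [h] at h'
    simpa using h'
  have key : ∀ U : Matrix (Fin Nn) (Fin Nn) ℂ, Uᴴ * U = 1 →
      (U * R2)ᴴ * (U * R1) = R2 * R1 := by
    intro U hU
    rw [conjTranspose_mul, hR2h, Matrix.mul_assoc, ← Matrix.mul_assoc Uᴴ, hU, Matrix.one_mul]
  have hU1 : (B0 * B1)ᴴ * (B0 * B1) = 1 := by
    rw [conjTranspose_mul, Matrix.mul_assoc, ← Matrix.mul_assoc B0ᴴ, hB0u, Matrix.one_mul, hB1u]
  have hU2 : (B1 * B0)ᴴ * (B1 * B0) = 1 := by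
    rw [conjTranspose_mul, Matrix.mul_assoc, ← Matrix.mul_assoc B1ᴴ, hB1u, Matrix.one_mul, hB0u]
  have e := key _ hU1
  rw [h1, h2, conjTranspose_smul, Matrix.smul_mul, Matrix.mul_smul, key _ hU2, smul_smul,
    pow_two, ← mul_assoc, hn, one_mul] at e
  have e2 : (om 3 - 1) • (R2 * R1) = 0 := by
    rw [sub_smul, e, one_smul, sub_self]
  exact (smul_eq_zero.mp e2).resolve_left (sub_ne_zero.mpr hne)
end
end

section
/- Let B be an N×N complex matrix with B†B ≤ 𝟙_N and BB† ≤ 𝟙_N, and let R be an orthogonal projection on ℂ^N such that the compression RBR is unitary on the range of R, i.e. (RBR)†(RBR) = R and (RBR)(RBR)† = R. Then B commutes with R: BR = RB (so B is block diagonal with respect to the decomposition ran(R) ⊕ ran(R)^⊥). -/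
open Matrix Kronecker Finset
open scoped ComplexOrder

noncomputable section


theorem aux_block (Nn : ℕ) (B R : Matrix (Fin Nn) (Fin Nn) ℂ)
    (hB : ((1 : Matrix (Fin Nn) (Fin Nn) ℂ) - Bᴴ * B).PosSemidef)
    (hRh : Rᴴ = R) (hRp : R * R = R)
    (hcomp : (R * B * R)ᴴ * (R * B * R) = R) :
    B * R = R * B * R := by
  have h1 := (hB.conjTranspose_mul_mul_same R).trace_nonneg
  have h2 := (posSemidef_conjTranspose_mul_self (B * R - R * B * R)).trace_nonneg
  have hc : R * Bᴴ * R * B * R = R := by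
    have h := hcomp
    simp only [conjTranspose_mul, hRh] at h
    calc R * Bᴴ * R * B * R = R * Bᴴ * (R * R) * B * R := by rw [hRp]
      _ = R := by simpa only [mul_assoc] using h
  have h3 : (B * R - R * B * R)ᴴ * (B * R - R * B * R) = -(Rᴴ * (1 - Bᴴ * B) * R) := by
    have e : (B * R - R * B * R)ᴴ * (B * R - R * B * R)
        = R * Bᴴ * B * R - R * Bᴴ * R * B * R - R * Bᴴ * R * B * R
          + R * Bᴴ * (R * R) * B * R := by
      simp only [conjTranspose_sub, conjTranspose_mul, hRh]
      noncomm_ring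
    rw [e, hRp, hc, hRh, mul_sub, sub_mul, mul_one, hRp]
    noncomm_ring
  have h4 : ((B * R - R * B * R)ᴴ * (B * R - R * B * R)).trace = 0 := by
    refine le_antisymm ?_ h2
    rw [h3, trace_neg]
    exact neg_nonpos.mpr h1
  exact sub_eq_zero.mp (trace_conjTranspose_mul_self_eq_zero_iff.mp h4)

/-- a contraction whose compression to the range of a projection `R` is unitary on
that range is block diagonal, i.e. commutes with `R`. -/
theorem block_diagonal_of_unitary_compression (Nn : ℕ) (B R : Matrix (Fin Nn) (Fin Nn) ℂ)
    (hB : ((1 : Matrix (Fin Nn) (Fin Nn) ℂ) - Bᴴ * B).PosSemidef)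
    (hB' : ((1 : Matrix (Fin Nn) (Fin Nn) ℂ) - B * Bᴴ).PosSemidef)
    (hRh : Rᴴ = R) (hRp : R * R = R)
    (hcomp : (R * B * R)ᴴ * (R * B * R) = R)
    (hcomp' : (R * B * R) * (R * B * R)ᴴ = R) :
    B * R = R * B := by
  have h1 := aux_block Nn B R hB hRh hRp hcomp
  have h2 := aux_block Nn Bᴴ R (by simpa using hB') hRh hRp
    (by simpa [conjTranspose_mul, hRh, mul_assoc] using hcomp')
  have h3 := congrArg conjTranspose h2
  simp only [conjTranspose_mul, hRh, conjTranspose_conjTranspose] at h3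
  exact (h1.trans (mul_assoc _ _ _)).trans h3.symm
end
end

section
/- Fix d ≥ 2 and reals α_0,…,α_{d-1} > 0 with ∑_i α_i² = 1 and α_i ≥ 1/d for i = 0,…,d−2, and fix integers ξ_0,…,ξ_{d-1} that are pairwise incongruent modulo d²−d+1. Define λ_i = 1/(d²α_i²) for i = 0,…,d−2 and Λ = (d − ∑_{i=0}^{d-2} λ_i)/(d²−d+1); set μ_i = √((1−λ_i)/((d²−d+1)Λ)) for i ≤ d−2 and μ_{d-1} = √(1/((d²−d+1)Λ)). Define vectors δ_b ∈ ℂ^d by δ_i = |i⟩ for b = i ≤ d−2 and δ_b = ∑_{i=0}^{d-1} μ_i·exp(2πi·ξ_i(b−d+1)/(d²−d+1))·|i⟩ for b = d−1,…,d²−1, and operators I_b = λ_b|δ_b⟩⟨δ_b| with λ_b = λ_i for b = i ≤ d−2 and λ_b = Λ for b ≥ d−1. Then Λ > 0, each δ_b is a unit vector, each I_b is positive semidefinite, ∑_{b=0}^{d²-1} I_b = 𝟙_d, and Tr[I_b·ρ(α)] = 1/d² for every b, where ρ(α) = ∑_{i=0}^{d-1} α_i²|i⟩⟨i| is the reduced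 state of |ψ(α)⟩ on Bob's side. (Appendix E construction of a d²-outcome POVM giving uniformly random outcomes on a partially entangled state.) -/
open Matrix Kronecker Finset
open scoped ComplexOrder

noncomputable section


/-- `λ_i = 1/(d²α_i²)`. -/
def lamSmall (d : ℕ) (α : Fin d → ℝ) (i : Fin d) : ℝ := 1 / ((d : ℝ) ^ 2 * α i ^ 2)

/-- `Λ = (d − ∑_{i=0}^{d-2} λ_i)/(d²−d+1)`. -/
def bigLam (d : ℕ) (α : Fin d → ℝ) : ℝ :=
  ((d : ℝ) - ∑ i ∈ Finset.univ.filter (fun i : Fin d => (i : ℕ) ≤ d - 2), lamSmall d α i)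
    / ((d : ℝ) ^ 2 - d + 1)

/-- `μ_i = √((1−λ_i)/((d²−d+1)Λ))` for `i ≤ d−2` and `μ_{d-1} = √(1/((d²−d+1)Λ))`. -/
def muCoef (d : ℕ) (α : Fin d → ℝ) (i : Fin d) : ℝ :=
  if (i : ℕ) ≤ d - 2 then
    Real.sqrt ((1 - lamSmall d α i) / (((d : ℝ) ^ 2 - d + 1) * bigLam d α))
  else Real.sqrt (1 / (((d : ℝ) ^ 2 - d + 1) * bigLam d α))

/-- The vectors `δ_b`: `δ_b = |b⟩` for `b ≤ d−2` and
`δ_b = ∑_i μ_i·exp(2πi·ξ_i(b−d+1)/(d²−d+1))|i⟩` for `b ≥ d−1`. -/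
def deltaVec (d : ℕ) (α : Fin d → ℝ) (ξ : Fin d → ℤ) (b : Fin (d ^ 2)) : Fin d → ℂ :=
  if (b : ℕ) ≤ d - 2 then (fun i => if (i : ℕ) = (b : ℕ) then 1 else 0)
  else fun i => ((muCoef d α i : ℝ) : ℂ) *
    Complex.exp (2 * Real.pi * Complex.I * (ξ i : ℂ) * (((b : ℕ) - (d - 1) : ℕ) : ℂ)
      / ((d : ℂ) ^ 2 - d + 1))

/-- The weights `λ_b`: `λ_b = λ_i = 1/(d²α_i²)` for `b = i ≤ d−2`, and `λ_b = Λ` otherwise. -/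
def lamB (d : ℕ) (α : Fin d → ℝ) (b : Fin (d ^ 2)) : ℝ :=
  if h : (b : ℕ) ≤ d - 2 then
    lamSmall d α ⟨(b : ℕ), by
      have hb := b.2
      rcases Nat.eq_zero_or_pos d with h0 | h0
      · exact absurd hb (by simp [h0])
      · omega⟩
  else bigLam d α

/-- The POVM elements `I_b = λ_b |δ_b⟩⟨δ_b|`. -/
def povmEl (d : ℕ) (α : Fin d → ℝ) (ξ : Fin d → ℤ) (b : Fin (d ^ 2)) :
    Matrix (Fin d) (Fin d) ℂ :=
  ((lamB d α b : ℝ) : ℂ) • Matrix.vecMulVec (deltaVec d α ξ b) (star (deltaVec d α ξ b))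


def wt (d : ℕ) (α : Fin d → ℝ) (i : Fin d) : ℝ := if (i : ℕ) ≤ d - 2 then lamSmall d α i else 0

lemma geom_zero (N : ℕ) (hN : 0 < N) (a b : ℤ) (h : ¬ (a ≡ b [ZMOD (N : ℤ)])) :
    ∑ k : Fin N, Complex.exp (2 * Real.pi * Complex.I * (a : ℂ) * ((k : ℕ) : ℂ) / (N : ℂ)) *
      (starRingEnd ℂ) (Complex.exp (2 * Real.pi * Complex.I * (b : ℂ) * ((k : ℕ) : ℂ) / (N : ℂ)))
      = 0 := by
  have hN' : (N : ℂ) ≠ 0 := by exact_mod_cast hN.ne'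
  set z : ℂ := Complex.exp (2 * Real.pi * Complex.I * ((a : ℂ) - b) / N) with hz
  have h1 : ∀ k : Fin N, Complex.exp (2 * Real.pi * Complex.I * (a : ℂ) * ((k : ℕ) : ℂ) / (N : ℂ)) *
      (starRingEnd ℂ) (Complex.exp (2 * Real.pi * Complex.I * (b : ℂ) * ((k : ℕ) : ℂ) / (N : ℂ)))
      = z ^ (k : ℕ) := by
    intro k
    rw [← Complex.exp_conj, ← Complex.exp_add, hz, ← Complex.exp_nat_mul]
    congr 1
    simp only [map_div₀, map_mul, Complex.conj_I, Complex.conj_ofReal, map_natCast, map_intCast,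
      map_ofNat]
    ring
  rw [Finset.sum_congr rfl (fun k _ => h1 k), Fin.sum_univ_eq_sum_range (fun k => z ^ k)]
  have hne : z ≠ 1 := by
    intro h2
    rw [hz, Complex.exp_eq_one_iff] at h2
    obtain ⟨n, hn⟩ := h2
    apply h
    have hpi : (2 * Real.pi * Complex.I : ℂ) ≠ 0 := Complex.two_pi_I_ne_zero
    have h3 : (a : ℂ) - b = n * N := by
      rw [div_eq_iff hN'] at hn
      apply mul_left_cancel₀ hpi
      rw [hn]; ring
    have h4 : a - b = n * N := by exact_mod_cast h3
    exact (Int.modEq_iff_dvd.mpr ⟨n, by rw [h4]; ring⟩).symm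
  have hzN : z ^ N = 1 := by
    rw [hz, ← Complex.exp_nat_mul, Complex.exp_eq_one_iff]
    exact ⟨a - b, by push_cast; field_simp⟩
  rw [geom_sum_eq hne, hzN]; simp

lemma exp_conj_one (N : ℕ) (a : ℤ) (k : ℕ) :
    Complex.exp (2 * Real.pi * Complex.I * (a : ℂ) * (k : ℂ) / (N : ℂ)) *
      (starRingEnd ℂ) (Complex.exp (2 * Real.pi * Complex.I * (a : ℂ) * (k : ℂ) / (N : ℂ)))
      = 1 := by
  rw [← Complex.exp_conj, ← Complex.exp_add, Complex.exp_eq_one_iff]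
  refine ⟨0, ?_⟩
  simp only [map_div₀, map_mul, Complex.conj_I, Complex.conj_ofReal, map_natCast, map_intCast,
      map_ofNat]
  push_cast
  ring

/-- Appendix E: the construction gives a `d²`-outcome POVM whose outcomes are
uniformly distributed on the reduced state `ρ(α) = ∑ α_i²|i⟩⟨i|`. -/
theorem povm_construction (d : ℕ) [NeZero d] (hd : 2 ≤ d)
    (α : Fin d → ℝ) (hpos : ∀ i, 0 < α i) (hnorm : ∑ i, α i ^ 2 = 1)
    (hbig : ∀ i : Fin d, (i : ℕ) ≤ d - 2 → 1 / (d : ℝ) ≤ α i)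
    (ξ : Fin d → ℤ)
    (hξ : ∀ i j : Fin d, i ≠ j → ¬ (ξ i ≡ ξ j [ZMOD ((d : ℤ) ^ 2 - d + 1)])) :
    0 < bigLam d α
    ∧ (∀ b, ∑ i, Complex.normSq (deltaVec d α ξ b i) = 1)
    ∧ (∀ b, (povmEl d α ξ b).PosSemidef)
    ∧ (∑ b, povmEl d α ξ b = 1)
    ∧ (∀ b, Matrix.trace (povmEl d α ξ b
        * Matrix.diagonal (fun i => ((α i ^ 2 : ℝ) : ℂ))) = ((d : ℂ) ^ 2)⁻¹) := by
  obtain ⟨N, hN⟩ : ∃ N : ℕ, d ^ 2 = (d - 1) + N := ⟨d ^ 2 - (d - 1), by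
    have : d ≤ d ^ 2 := Nat.le_self_pow (by norm_num) d
    omega⟩
  have hNR : (d : ℝ) ^ 2 - d + 1 = N := by
    have : ((d ^ 2 : ℕ) : ℝ) = ((d - 1 + N : ℕ) : ℝ) := by rw [hN]
    push_cast [Nat.cast_sub (show 1 ≤ d by omega)] at this
    linarith
  have hNC : (d : ℂ) ^ 2 - d + 1 = N := by exact_mod_cast congrArg (fun x : ℝ => (x : ℂ)) hNR
  have hNZ : (d : ℤ) ^ 2 - d + 1 = N := by exact_mod_cast hNR
  have hdR : (2 : ℝ) ≤ d := by exact_mod_cast hd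
  have hNpos : (0 : ℝ) < N := by rw [← hNR]; nlinarith
  have hNn : 0 < N := by exact_mod_cast hNpos
  have hlam0 : ∀ i, 0 < lamSmall d α i := fun i => by
    have := hpos i
    unfold lamSmall; positivity
  have hlamα : ∀ i, lamSmall d α i * α i ^ 2 = 1 / (d : ℝ) ^ 2 := fun i => by
    have := hpos i
    unfold lamSmall; field_simp
  have hlam1 : ∀ i : Fin d, (i : ℕ) ≤ d - 2 → lamSmall d α i ≤ 1 := fun i hi => by
    have h1 := hbig i hi
    have := hpos i
    rw [div_le_iff₀ (by positivity)] at h1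
    unfold lamSmall
    rw [div_le_one (by positivity)]
    nlinarith
  have hw1 : ∀ i, wt d α i ≤ 1 := fun i => by
    unfold wt; split_ifs with h
    · exact hlam1 i h
    · norm_num
  have hcard : (Finset.univ.filter (fun i : Fin d => (i : ℕ) ≤ d - 2)).card = d - 1 := by
    have : (Finset.univ.filter (fun i : Fin d => (i : ℕ) ≤ d - 2))
        = Finset.Iio (⟨d - 1, by omega⟩ : Fin d) := by
      ext i; simp [Fin.lt_def]; omega
    rw [this, Fin.card_Iio]
  have hΛ : (N : ℝ) * bigLam d α = d - ∑ i, wt d α i := by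
    unfold bigLam wt
    rw [hNR, Finset.sum_filter]
    field_simp
  have hsum : ∑ i, wt d α i ≤ d - 1 := by
    unfold wt
    rw [← Finset.sum_filter]
    refine (Finset.sum_le_card_nsmul _ _ 1 (fun i hi => hlam1 i (by simpa using hi))).trans ?_
    rw [hcard]
    simp [Nat.cast_sub (show 1 ≤ d by omega)]
  have hNΛ : 0 < (N : ℝ) * bigLam d α := by rw [hΛ]; linarith
  have hΛpos : 0 < bigLam d α := pos_of_mul_pos_right hNΛ hNpos.le
  have hmu : ∀ i, muCoef d α i ^ 2 = (1 - wt d α i) / (N * bigLam d α) := fun i => by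
    have h0 : 0 ≤ (1 - wt d α i) / (N * bigLam d α) :=
      div_nonneg (by linarith [hw1 i]) hNΛ.le
    have : muCoef d α i = Real.sqrt ((1 - wt d α i) / (N * bigLam d α)) := by
      unfold muCoef wt; rw [hNR]; split_ifs <;> simp
    rw [this, Real.sq_sqrt h0]
  have hδ : ∀ (b : Fin (d ^ 2)) (i : Fin d), ¬ (b : ℕ) ≤ d - 2 →
      deltaVec d α ξ b i * (starRingEnd ℂ) (deltaVec d α ξ b i)
        = (((1 - wt d α i) / (N * bigLam d α) : ℝ) : ℂ) := fun b i hb => by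
    unfold deltaVec
    rw [if_neg hb, hNC, ← hmu, map_mul, mul_mul_mul_comm, exp_conj_one, Complex.conj_ofReal]
    push_cast; ring
  have hlamBpos : ∀ b, 0 < lamB d α b := fun b => by
    unfold lamB; split_ifs
    · exact hlam0 _
    · exact hΛpos
  refine ⟨hΛpos, ?_, ?_, ?_, ?_⟩
  · intro b
    by_cases hb : (b : ℕ) ≤ d - 2
    · rw [Finset.sum_eq_single (⟨b, by omega⟩ : Fin d)]
      · simp [deltaVec, hb]
      · intro i _ hi
        have : (i : ℕ) ≠ b := fun h => hi (Fin.ext h)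
        simp [deltaVec, hb, this]
      · simp
    · have : ∀ i, Complex.normSq (deltaVec d α ξ b i) = (1 - wt d α i) / (N * bigLam d α) := by
        intro i
        have := hδ b i hb
        rw [Complex.mul_conj] at this
        exact_mod_cast this
      simp_rw [this]
      rw [← Finset.sum_div, Finset.sum_sub_distrib, hΛ]
      rw [hΛ] at hNΛ
      simp
      exact hNΛ.ne'
  · intro b
    unfold povmEl
    refine (Matrix.posSemidef_vecMulVec_self_star _).smul ?_
    exact_mod_cast (hlamBpos b).le
  · ext i j
    rw [Matrix.sum_apply, ← (finCongr hN.symm).sum_comp, Fin.sum_univ_add]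
    have e1 : ∑ k : Fin (d - 1), povmEl d α ξ (finCongr hN.symm (Fin.castAdd N k)) i j
        = if i = j then ((wt d α i : ℝ) : ℂ) else 0 := by
      have hk : ∀ k : Fin (d - 1), povmEl d α ξ (finCongr hN.symm (Fin.castAdd N k)) i j
        = if (i : ℕ) = k ∧ i = j then ((wt d α i : ℝ) : ℂ) else 0 := by
        intro k
        have hk2 : (k : ℕ) ≤ d - 2 := by omega
        by_cases hik : (i : ℕ) = k
        · have hi2 : (i : ℕ) ≤ d - 2 := by omega
          have : (⟨(k : ℕ), by omega⟩ : Fin d) = i := Fin.ext hik.symm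
          by_cases hij : i = j
          · subst hij
            simp [povmEl, lamB, deltaVec, vecMulVec_apply, hk2, wt, this, hik]
          · have : (j : ℕ) ≠ k := fun h => hij (Fin.ext (hik.trans h.symm))
            simp [povmEl, deltaVec, vecMulVec_apply, hk2, this, hij]
        · simp [povmEl, deltaVec, vecMulVec_apply, hk2, hik]
      rw [Finset.sum_congr rfl (fun k _ => hk k)]
      by_cases hij : i = j
      · by_cases hi2 : (i : ℕ) ≤ d - 2
        · rw [Finset.sum_eq_single (⟨i, by omega⟩ : Fin (d - 1))]
          · simp
          · intro k _ hki
            have : ¬ (i : ℕ) = k := fun h => hki (Fin.ext h.symm)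
            simp [this]
          · simp
        · simp [wt, hi2]
      · simp [hij]
    have hb : ∀ k : Fin N, ¬ ((finCongr hN.symm (Fin.natAdd (d - 1) k) : Fin (d ^ 2)) : ℕ) ≤ d - 2 := by
      intro k
      simp
      omega
    have e2 : ∑ k : Fin N, povmEl d α ξ (finCongr hN.symm (Fin.natAdd (d - 1) k)) i j
        = if i = j then ((1 - wt d α i : ℝ) : ℂ) else 0 := by
      by_cases hij : i = j
      · subst hij
        have hk : ∀ k : Fin N, povmEl d α ξ (finCongr hN.symm (Fin.natAdd (d - 1) k)) i i
            = (((1 - wt d α i) / N : ℝ) : ℂ) := by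
          intro k
          have := hδ _ i (hb k)
          simp only [povmEl, Matrix.smul_apply, vecMulVec_apply, Pi.star_apply, smul_eq_mul]
          rw [← starRingEnd_apply, this]
          unfold lamB
          rw [dif_neg (hb k), ← Complex.ofReal_mul]
          congr 1
          field_simp
        rw [Finset.sum_congr rfl (fun k _ => hk k)]
        rw [if_pos rfl, Finset.sum_const, Finset.card_univ, Fintype.card_fin, nsmul_eq_mul]
        rw [← Complex.ofReal_natCast, ← Complex.ofReal_mul]
        congr 1
        field_simp
      · rw [if_neg hij]
        have hg := geom_zero N hNn (ξ i) (ξ j) (by rw [← hNZ]; exact hξ i j hij)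
        have hk : ∀ k : Fin N, povmEl d α ξ (finCongr hN.symm (Fin.natAdd (d - 1) k)) i j
            = ((bigLam d α * muCoef d α i * muCoef d α j : ℝ) : ℂ) * (
            Complex.exp (2 * Real.pi * Complex.I * (ξ i : ℂ) * ((k : ℕ) : ℂ) / (N : ℂ)) *
      (starRingEnd ℂ) (Complex.exp (2 * Real.pi * Complex.I * (ξ j : ℂ) * ((k : ℕ) : ℂ) / (N : ℂ)))) := by
          intro k
          simp only [povmEl, Matrix.smul_apply, vecMulVec_apply, Pi.star_apply, smul_eq_mul]
          rw [← starRingEnd_apply]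
          unfold lamB deltaVec
          rw [dif_neg (hb k), if_neg (hb k), hNC, map_mul, Complex.conj_ofReal]
          have : ((finCongr hN.symm (Fin.natAdd (d - 1) k) : Fin (d ^ 2)) : ℕ) - (d - 1) = k := by
            simp
          rw [this]
          push_cast
          ring
        rw [Finset.sum_congr rfl (fun k _ => hk k), ← Finset.mul_sum, hg, mul_zero]
    rw [e1, e2, Matrix.one_apply]
    split_ifs <;> simp
  · intro b
    have htr : Matrix.trace (povmEl d α ξ b
        * Matrix.diagonal (fun i => ((α i ^ 2 : ℝ) : ℂ)))
        = ∑ i, (lamB d α b : ℂ) * (deltaVec d α ξ b i * (starRingEnd ℂ) (deltaVec d α ξ b i))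
          * ((α i ^ 2 : ℝ) : ℂ) := by
      simp only [Matrix.trace, Matrix.diag_apply, Matrix.mul_diagonal, povmEl, Matrix.smul_apply,
        vecMulVec_apply, Pi.star_apply, smul_eq_mul, starRingEnd_apply]
    rw [htr]
    by_cases hb : (b : ℕ) ≤ d - 2
    · rw [Finset.sum_eq_single (⟨b, by omega⟩ : Fin d)]
      · have := hlamα ⟨b, by omega⟩
        simp only [lamB, deltaVec, hb, dif_pos, if_true, map_one, mul_one]
        rw [← Complex.ofReal_mul, this]
        push_cast; simp
      · intro i _ hi
        have : (i : ℕ) ≠ b := fun h => hi (Fin.ext h)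
        simp [deltaVec, hb, this]
      · simp
    · have hk : ∀ i, (lamB d α b : ℂ) * (deltaVec d α ξ b i * (starRingEnd ℂ) (deltaVec d α ξ b i))
          * ((α i ^ 2 : ℝ) : ℂ) = (((α i ^ 2 - wt d α i * α i ^ 2) / N : ℝ) : ℂ) := by
        intro i
        rw [hδ b i hb]
        unfold lamB
        rw [dif_neg hb, ← Complex.ofReal_mul, ← Complex.ofReal_mul]
        congr 1
        field_simp
      rw [Finset.sum_congr rfl (fun k _ => hk k), ← Complex.ofReal_sum, ← Finset.sum_div,
        Finset.sum_sub_distrib, hnorm]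
      have hw : ∑ i, wt d α i * α i ^ 2 = (d - 1) / (d : ℝ) ^ 2 := by
        have : ∀ i, wt d α i * α i ^ 2 = if (i : ℕ) ≤ d - 2 then 1 / (d : ℝ) ^ 2 else 0 := by
          intro i
          unfold wt
          split_ifs
          · exact hlamα i
          · simp
        simp_rw [this]
        rw [← Finset.sum_filter, Finset.sum_const, hcard, nsmul_eq_mul,
          Nat.cast_sub (show 1 ≤ d by omega)]
        push_cast; ring
      have : (1 - ∑ i, wt d α i * α i ^ 2) / (N : ℝ) = ((d : ℝ) ^ 2)⁻¹ := by
        rw [hw]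
        have hd0 : (d : ℝ) ≠ 0 := by positivity
        rw [div_eq_iff hNpos.ne', ← hNR]
        field_simp
        ring
      rw [this]
      push_cast; rfl
end
end
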